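/- Let K be a field and let X = K⁵ with basis vectors denoted x, y₁, y₂, z₁₂, z₂₁. Define K-linear maps D₁, D₂ : X → X on this basis by D₁(x) = y₁, D₁(y₂) = z₁₂, D₁(y₁) = D₁(z₁₂) = D₁(z₂₁) = 0, and D₂(x) = y₂, D₂(y₁) = z₂₁, D₂(y₂) = D₂(z₁₂) = D₂(z₂₁) = 0. Then: (a) D₁∘D₁ = 0 and D₂∘D₂ = 0, and for each i ∈ {1,2} the multiplication on K × X defined by (s,v)·(t,w) := (0, s•Dᵢ(w) + t•Dᵢ(v)) is associative; but (b) there exist no non-unital associative K-algebra A, injective K-linear map j : X → A, and elements β₁, β₂ ∈ A such that βᵢ·j(v) = j(Dᵢ(v)) = j(v)·βᵢ for all v ∈ X and i ∈ {1,2}. -/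

import Mathlib

/-- If `D` squares to zero, the multiplication it induces on `K × X` is associative. -/
theorem mul_assoc_of_comp_self_eq_zero {K X : Type*} [CommRing K] [AddCommGroup X] [Module K X]
    {D : X →ₗ[K] X} (hD : D ∘ₗ D = 0) {m : K × X → K × X → K × X}
    (hm : ∀ p q, m p q = ((0 : K), p.1 • D q.2 + q.1 • D p.2)) (p q r : K × X) :
    m (m p q) r = m p (m q r) := by
  have hDD (v : X) : D (D v) = 0 := LinearMap.congr_fun hD v
  simp [hm, hDD]

/-- If left multiplication by `β₁` and right multiplication by `β₂` realise `D₁` and `D₂` on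
an embedded `X`, then `D₁` and `D₂` commute. -/
theorem apply_comm_of_realised {X A : Type*} [Semigroup A] {D₁ D₂ : X → X} {j : X → A}
    (hj : Function.Injective j) {β₁ β₂ : A} (h₁ : ∀ v, β₁ * j v = j (D₁ v))
    (h₂ : ∀ v, j v * β₂ = j (D₂ v)) (v : X) : D₁ (D₂ v) = D₂ (D₁ v) :=
  hj <| by rw [← h₁, ← h₂, ← h₂, ← h₁, mul_assoc]


/-- The variety of (non-unital) associative `K`-algebras is not action representable:
with `X = K⁵` (basis `x = e₀, y₁ = e₁, y₂ = e₂, z₁₂ = e₃, z₂₁ = e₄`) and the linear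
maps `D₁, D₂` given by `D₁(x) = y₁, D₁(y₂) = z₁₂`, `D₂(x) = y₂, D₂(y₁) = z₂₁` (zero on
the other basis vectors): (a) `D₁² = 0 = D₂²` and each `Dᵢ` gives an associative
semidirect-product multiplication on `K × X`; but (b) the two actions cannot be realised
simultaneously inside any non-unital associative `K`-algebra `A` containing `X`. -/
theorem associative_algebras_not_action_representable
    {K : Type*} [Field K]
    (D₁ D₂ : (Fin 5 → K) →ₗ[K] (Fin 5 → K))
    (hD₁ : D₁ (Pi.single 0 1) = Pi.single 1 1 ∧ D₁ (Pi.single 2 1) = Pi.single 3 1 ∧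
           D₁ (Pi.single 1 1) = 0 ∧ D₁ (Pi.single 3 1) = 0 ∧ D₁ (Pi.single 4 1) = 0)
    (hD₂ : D₂ (Pi.single 0 1) = Pi.single 2 1 ∧ D₂ (Pi.single 1 1) = Pi.single 4 1 ∧
           D₂ (Pi.single 2 1) = 0 ∧ D₂ (Pi.single 3 1) = 0 ∧ D₂ (Pi.single 4 1) = 0) :
    -- (a) each `Dᵢ` squares to zero and yields an associative multiplication on `K × X`
    (D₁ ∘ₗ D₁ = 0) ∧ (D₂ ∘ₗ D₂ = 0) ∧
    (∀ m : K × (Fin 5 → K) → K × (Fin 5 → K) → K × (Fin 5 → K),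
      (∀ p q, m p q = ((0 : K), p.1 • D₁ q.2 + q.1 • D₁ p.2)) →
      ∀ p q r, m (m p q) r = m p (m q r)) ∧
    (∀ m : K × (Fin 5 → K) → K × (Fin 5 → K) → K × (Fin 5 → K),
      (∀ p q, m p q = ((0 : K), p.1 • D₂ q.2 + q.1 • D₂ p.2)) →
      ∀ p q r, m (m p q) r = m p (m q r)) ∧
    -- (b) no associative algebra realises both actions simultaneously
    (∀ (A : Type) [NonUnitalRing A] [Module K A]
        [SMulCommClass K A A] [IsScalarTower K A A]
        (j : (Fin 5 → K) →ₗ[K] A), Function.Injective j →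
      ∀ β₁ β₂ : A,
        ¬((∀ v : Fin 5 → K, β₁ * j v = j (D₁ v) ∧ j v * β₁ = j (D₁ v)) ∧
          (∀ v : Fin 5 → K, β₂ * j v = j (D₂ v) ∧ j v * β₂ = j (D₂ v)))) := by
  obtain ⟨h0, h2, h1, h3, h4⟩ := hD₁
  obtain ⟨k0, k1, k2, k3, k4⟩ := hD₂
  have hD₁ : D₁ ∘ₗ D₁ = 0 := by
    refine (Pi.basisFun K (Fin 5)).ext fun i => ?_
    fin_cases i <;> simp [h0, h1, h2, h3, h4]
  have hD₂ : D₂ ∘ₗ D₂ = 0 := by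
    refine (Pi.basisFun K (Fin 5)).ext fun i => ?_
    fin_cases i <;> simp [k0, k1, k2, k3, k4]
  refine ⟨hD₁, hD₂, fun m hm => mul_assoc_of_comp_self_eq_zero hD₁ hm,
    fun m hm => mul_assoc_of_comp_self_eq_zero hD₂ hm, ?_⟩
  rintro A _ _ _ _ j hj β₁ β₂ ⟨hβ₁, hβ₂⟩
  have h := apply_comm_of_realised hj (fun v => (hβ₁ v).1) (fun v => (hβ₂ v).2) (Pi.single 0 1)
  rw [k0, h2, h0, k1] at h
  simpa using congrFun h 3
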